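/- For every integer n ≥ 0, there exist integers a and b such that 2^{−⌊5n/2⌋+2}·L_n·I_n = a + b·π. -/

import Mathlib

open scoped Classical

/-- The rational function `R_n(x) = 5 x^{2n} (x⁴+6x²+25)^{2n} / ((5+x)^{3n+1} (5-x)^{3n+1})`. -/
noncomputable def R (n : ℕ) : ℂ → ℂ := fun x =>
  5 * x ^ (2 * n) * (x ^ 4 + 6 * x ^ 2 + 25) ^ (2 * n) /
    ((5 + x) ^ (3 * n + 1) * (5 - x) ^ (3 * n + 1))

/-- `inP n p` : `p` belongs to the set `𝒫_n` of primes `p > max(5, √(3n))` with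
`1/2 ≤ {n/p} < 2/3`. -/
def inP (n p : ℕ) : Prop :=
  p.Prime ∧ max 5 (Real.sqrt (3 * n)) < (p : ℝ) ∧
    1 / 2 ≤ Int.fract ((n : ℝ) / p) ∧ Int.fract ((n : ℝ) / p) < 2 / 3

/-- `Φ_n = ∏_{p ∈ 𝒫_n} p` (note `𝒫_n ⊆ {p : p ≤ 2n}`). -/
noncomputable def Phi (n : ℕ) : ℕ :=
  ∏ p ∈ (Finset.range (2 * n + 1)).filter (fun p => inP n p), p

/-- `lcm(1, 2, …, m)`. -/
def lcmUpTo (m : ℕ) : ℕ := (Finset.Icc 1 m).lcm id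

/-- `L_n = lcm(1,2,…,4n) / Φ_n`. -/
noncomputable def L (n : ℕ) : ℕ := lcmUpTo (4 * n) / Phi n

/-- `I_n = i (-1)^{n+1} ∫ R_n(x) dx` along the straight segment from `-1-2i` to `-1+2i`. -/
noncomputable def In (n : ℕ) : ℂ :=
  Complex.I * (-1) ^ (n + 1) *
    ∫ t in (-1 : ℝ)..1, R n (-1 + 2 * Complex.I * t) * (2 * Complex.I)

open Polynomial in
/-- After the substitution `x = 5 - 10 t`, the numerator of `R n` is a multiple of the `2n`-th power
of this polynomial. -/
noncomputable def quinticT : ℤ[X] :=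
  (1 - 2 * X) * (2 - 6 * X + 5 * X ^ 2) * (1 - 4 * X + 5 * X ^ 2)

/-- The Taylor coefficients at `t = 0` of `quinticT ^ (2n) / (1 - t) ^ (3n+1)`. -/
noncomputable def taylorCoeff (n m : ℕ) : ℤ :=
  PowerSeries.coeff m
    (((quinticT ^ (2 * n) : Polynomial ℤ) : PowerSeries ℤ) * (PowerSeries.mk 1) ^ (3 * n + 1))

section ModP

variable {p : ℕ} [Fact p.Prime]

lemma sum_pow_eq_zero_of_lt {i : ℕ} (hi : i < 2 * p - 2) (hi' : i ≠ p - 1) :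
    ∑ x : ZMod p, x ^ i = 0 := by
  rcases lt_or_gt_of_ne hi' with h | h
  · exact FiniteField.sum_pow_lt_card_sub_one _ _ (by rwa [ZMod.card])
  · have key : ∀ x : ZMod p, x ^ i = x ^ (i - p + 1) := fun x => by
      conv_lhs => rw [show i = (i - p) + p by omega, pow_add, ZMod.pow_card]
      rw [pow_succ]
    simp_rw [key]
    exact FiniteField.sum_pow_lt_card_sub_one _ _ (by rw [ZMod.card]; omega)

lemma sum_pow_card_sub_one_ne_zero : ∑ x : ZMod p, x ^ (p - 1) ≠ 0 := by
  have h : ∀ x : ZMod p, x ^ (p - 1) = 1 - if x = 0 then 1 else 0 := fun x => by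
    rw [ZMod.pow_card_sub_one]; split_ifs <;> simp_all
  simp_rw [h]
  simp

open Polynomial in
/-- A polynomial over `𝔽_p` that is odd about `1/2` and of degree less than `2p - 2` has no term of
degree `p - 1`. -/
lemma coeff_card_sub_one_eq_zero_of_comp_one_sub (hp : 2 < p) {f : (ZMod p)[X]}
    (hf : f.comp (1 - X) = -f) (hdeg : f.natDegree < 2 * p - 2) : f.coeff (p - 1) = 0 := by
  have hsum : ∑ x : ZMod p, f.eval x = f.coeff (p - 1) * ∑ x : ZMod p, x ^ (p - 1) := by
    simp_rw [eval_eq_sum_range' hdeg]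
    rw [Finset.sum_comm, Finset.sum_eq_single (p - 1)]
    · rw [Finset.mul_sum]
    · intro i hi hne
      rw [← Finset.mul_sum, sum_pow_eq_zero_of_lt (Finset.mem_range.1 hi) hne, mul_zero]
    · intro h
      exact absurd (Finset.mem_range.2 (by omega)) h
  have hneg : ∑ x : ZMod p, f.eval x = -∑ x : ZMod p, f.eval x := by
    conv_lhs => rw [← Equiv.sum_comp (Equiv.subLeft (1 : ZMod p))]
    rw [← Finset.sum_neg_distrib]
    refine Finset.sum_congr rfl fun x _ => ?_
    have := congrArg (eval x) hf
    simpa [eval_comp] using this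
  have h2 : (2 : ZMod p) ≠ 0 := by
    intro h
    have : ((2 : ℕ) : ZMod p) = 0 := by exact_mod_cast h
    rw [ZMod.natCast_eq_zero_iff] at this
    exact absurd (Nat.le_of_dvd (by norm_num) this) (by omega)
  have h0 : ∑ x : ZMod p, f.eval x = 0 := by
    have : (2 : ZMod p) * ∑ x : ZMod p, f.eval x = 0 := by
      rw [two_mul]; nth_rewrite 1 [hneg]; ring
    exact (mul_eq_zero.1 this).resolve_left h2
  rw [hsum] at h0
  exact (mul_eq_zero.1 h0).resolve_right sum_pow_card_sub_one_ne_zero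

lemma coeff_pow_card_eq_zero (F : PowerSeries (ZMod p)) {m : ℕ} (hm : ¬ p ∣ m) :
    PowerSeries.coeff m (F ^ p) = 0 := by
  have hp : p ≠ 0 := (Fact.out : p.Prime).ne_zero
  have h : PowerSeries.expand p hp F = F ^ p := by
    have := MvPowerSeries.map_frobenius_expand p hp (f := F)
    rw [ZMod.frobenius_zmod] at this
    simpa [PowerSeries.expand] using this
  rw [← h, PowerSeries.coeff_expand_of_not_dvd p hp F hm]

open Polynomial in
lemma natDegree_quinticT_map_le : (quinticT.map (Int.castRingHom (ZMod p))).natDegree ≤ 5 := by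
  refine (natDegree_map_le).trans ?_
  unfold quinticT
  compute_degree

open Polynomial in
lemma quinticT_comp_one_sub : quinticT.comp (1 - X) = -quinticT := by
  simp [quinticT]
  ring

open Polynomial in
lemma coeff_quinticT_pow_mul_eq_zero {r m : ℕ} (h1 : p ≤ 2 * r) (h2 : 3 * r < 2 * p)
    (hp : 2 < p) (hm : (m : ℤ) ≡ 3 * r [ZMOD p]) :
    (quinticT.map (Int.castRingHom (ZMod p)) ^ (2 * r - p) *
      (1 - X) ^ (2 * p - 3 * r - 1)).coeff m = 0 := by
  set f := quinticT.map (Int.castRingHom (ZMod p)) with hf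
  set e := 2 * p - 3 * r - 1 with he
  have hodd : Odd (2 * r - p) := by
    have := (Fact.out : p.Prime).eq_two_or_odd'
    rcases this with h | h
    · omega
    · obtain ⟨k, hk⟩ := h
      exact ⟨r - k - 1, by omega⟩
  set N : (ZMod p)[X] := f ^ (2 * r - p) * (X ^ e * (1 - X) ^ e) with hN
  have hdegN : N.natDegree ≤ 5 * (2 * r - p) + 2 * e := by
    have h5 : f.natDegree ≤ 5 := natDegree_quinticT_map_le
    have h6 : (1 - X : (ZMod p)[X]).natDegree ≤ 1 := by compute_degree
    calc N.natDegree ≤ (f ^ (2 * r - p)).natDegree +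
          ((X ^ e : (ZMod p)[X]).natDegree + ((1 - X : (ZMod p)[X]) ^ e).natDegree) :=
          natDegree_mul_le.trans (add_le_add_right natDegree_mul_le _)
      _ ≤ (2 * r - p) * 5 + (e * 1 + e * 1) := by
          refine add_le_add (natDegree_pow_le_of_le _ h5) (add_le_add ?_ ?_)
          · simp
          · exact natDegree_pow_le_of_le _ h6
      _ = _ := by ring
  have hcomp : N.comp (1 - X) = -N := by
    have hfc : f.comp (1 - X) = -f := by
      have := congrArg (Polynomial.map (Int.castRingHom (ZMod p))) quinticT_comp_one_sub
      simpa [Polynomial.map_comp, ← hf] using this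
    rw [hN]
    simp only [mul_comp, pow_comp, hfc, X_comp, sub_comp, one_comp, sub_sub_cancel,
      hodd.neg_pow]
    ring
  have hcoef : ∀ m', N.coeff (m' + e) =
      (f ^ (2 * r - p) * (1 - X) ^ e).coeff m' := fun m' => by
    rw [hN, show f ^ (2 * r - p) * (X ^ e * (1 - X) ^ e) =
      (f ^ (2 * r - p) * (1 - X) ^ e) * X ^ e by ring, coeff_mul_X_pow]
  rw [← hcoef]
  by_cases hbig : N.natDegree < m + e
  · exact coeff_eq_zero_of_natDegree_lt hbig
  · have hme : m + e = p - 1 := by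
      obtain ⟨c, hc⟩ := hm.dvd
      have hlt : ((m + e : ℕ) : ℤ) + 1 = p * (2 - c) := by
        rw [he]; push_cast [show 1 ≤ 2 * p - 3 * r by omega, show 3 * r ≤ 2 * p by omega]
        linarith
      have hub : (p : ℤ) * (2 - c) < p * 2 := by
        rw [← hlt]; omega
      have hlb : (p : ℤ) * 0 < p * (2 - c) := by
        rw [← hlt]; omega
      have hp0 : (0 : ℤ) < p := by omega
      have a1 := lt_of_mul_lt_mul_left hub hp0.le
      have a2 := lt_of_mul_lt_mul_left hlb hp0.le
      have : 2 - c = 1 := by omega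
      rw [this] at hlt
      omega
    rw [hme]
    exact coeff_card_sub_one_eq_zero_of_comp_one_sub hp hcomp (by omega)

/-- `p ∣ taylorCoeff n m` whenever `m ≡ 3n` modulo `p`, if `1/2 ≤ {n/p} < 2/3`. -/
lemma dvd_taylorCoeff {n m : ℕ} (h1 : p ≤ 2 * (n % p)) (h2 : 3 * (n % p) < 2 * p)
    (hp : 2 < p) (hm : (m : ℤ) ≡ 3 * n [ZMOD p]) : (p : ℤ) ∣ taylorCoeff n m := by
  set r := n % p with hr
  set k := n / p with hk
  have hn : n = p * k + r := (Nat.div_add_mod n p).symm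
  rw [← ZMod.intCast_zmod_eq_zero_iff_dvd]
  set f := quinticT.map (Int.castRingHom (ZMod p)) with hf
  set J : PowerSeries (ZMod p) := PowerSeries.mk 1 with hJ
  have hJ1 : J * (1 - PowerSeries.X) = 1 := PowerSeries.mk_one_mul_one_sub_eq_one _
  have hcast : ((taylorCoeff n m : ℤ) : ZMod p) =
      PowerSeries.coeff m (((f ^ (2 * n) : Polynomial (ZMod p)) : PowerSeries (ZMod p)) *
        J ^ (3 * n + 1)) := by
    rw [taylorCoeff, ← eq_intCast (Int.castRingHom (ZMod p)), ← PowerSeries.coeff_map, map_mul,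
      map_pow, hf, ← Polynomial.map_pow, ← Polynomial.polynomial_map_coe]
    congr 3
    ext i
    simp [hJ]
  have hfac : ((f ^ (2 * n) : Polynomial (ZMod p)) : PowerSeries (ZMod p)) * J ^ (3 * n + 1) =
      ((f : PowerSeries (ZMod p)) ^ (2 * k + 1) * J ^ (3 * k + 2)) ^ p *
      ((f ^ (2 * r - p) * (1 - Polynomial.X) ^ (2 * p - 3 * r - 1) : Polynomial (ZMod p)) :
        PowerSeries (ZMod p)) := by
    have e1 : 2 * n = p * (2 * k + 1) + (2 * r - p) := by
      have : p * (2 * k + 1) = 2 * (p * k) + p := by ring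
      omega
    have e2 : p * (3 * k + 2) = (3 * n + 1) + (2 * p - 3 * r - 1) := by
      have : p * (3 * k + 2) = 3 * (p * k) + 2 * p := by ring
      omega
    push_cast
    rw [mul_pow, ← pow_mul, ← pow_mul, mul_comm _ p, mul_comm _ p, e2, e1, pow_add, pow_add]
    have e3 : J ^ (2 * p - 3 * r - 1) * (1 - PowerSeries.X) ^ (2 * p - 3 * r - 1) = 1 := by
      rw [← mul_pow, hJ1, one_pow]
    linear_combination (-(f : PowerSeries (ZMod p)) ^ (p * (2 * k + 1)) *
      (f : PowerSeries (ZMod p)) ^ (2 * r - p) * J ^ (3 * n + 1)) * e3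
  rw [hcast, hfac, PowerSeries.coeff_mul]
  refine Finset.sum_eq_zero fun x hx => ?_
  by_cases hdvd : p ∣ x.1
  · rw [Polynomial.coeff_coe, coeff_quinticT_pow_mul_eq_zero h1 h2 hp, mul_zero]
    have hx' : x.1 + x.2 = m := Finset.HasAntidiagonal.mem_antidiagonal.1 hx
    obtain ⟨c, hc⟩ := hdvd
    obtain ⟨c', hc'⟩ := hm.dvd
    refine (Int.modEq_iff_dvd).2 ⟨c + c' - 3 * k, ?_⟩
    have a1 : (m : ℤ) = p * c + x.2 := by rw [← hx', hc]; push_cast; ring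
    have a2 : (n : ℤ) = p * k + r := by exact_mod_cast hn
    rw [a1, a2] at hc'
    linear_combination hc'
  · rw [coeff_pow_card_eq_zero _ hdvd, zero_mul]

end ModP

section Decomposition

open Polynomial

/-- After the substitution `x = 5 - 2 y`, the numerator of `R n` is a multiple of the `2n`-th power
of this polynomial. -/
noncomputable def quinticY : ℤ[X] :=
  (5 - 2 * X) * (X ^ 2 - 6 * X + 10) * (X ^ 2 - 4 * X + 5)

/-- The contribution of the poles `y = 0` and `y = 5` to `5 * quinticY ^ (2n)`, after multiplication
by `(y (5 - y)) ^ (3n+1)`. -/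
noncomputable def polePart (n : ℕ) : ℤ[X] :=
  ∑ d ∈ Finset.range (3 * n + 1), C (5 ^ d * taylorCoeff n (3 * n - d)) *
    (X ^ (3 * n - d) * (5 - X) ^ (3 * n + 1) + X ^ (3 * n + 1) * (5 - X) ^ (3 * n - d))

/-- `polePart`, in the variable `t = y / 5`. -/
noncomputable def polePartT (n : ℕ) : ℤ[X] :=
  ∑ d ∈ Finset.range (3 * n + 1), C (taylorCoeff n (3 * n - d)) *
    (X ^ (3 * n - d) * (1 - X) ^ (3 * n + 1) + X ^ (3 * n + 1) * (1 - X) ^ (3 * n - d))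

lemma quinticY_comp : quinticY.comp (C 5 * X) = C 125 * quinticT := by
  simp [quinticY, quinticT]
  ring

lemma polePart_comp (n : ℕ) :
    (polePart n).comp (C 5 * X) = C (5 ^ (6 * n + 1)) * polePartT n := by
  rw [polePart, polePartT, sum_comp, Finset.mul_sum]
  refine Finset.sum_congr rfl fun d hd => ?_
  have h1 : (5 - C 5 * X : ℤ[X]) = C 5 * (1 - X) := by simp; ring
  have h2 : (5 : ℤ) ^ (6 * n + 1) = 5 ^ d * 5 ^ (3 * n - d) * 5 ^ (3 * n + 1) := by
    rw [← pow_add, ← pow_add]; congr 1; have := Finset.mem_range.1 hd; omega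
  simp only [mul_comp, add_comp, pow_comp, X_comp, sub_comp, C_comp, ofNat_comp, Nat.cast_ofNat,
    h1, mul_pow]
  rw [h2]
  simp only [map_mul, map_pow]
  ring

lemma mul_coe_polePartT (n : ℕ) :
    (polePartT n : PowerSeries ℤ) * (PowerSeries.mk 1) ^ (3 * n + 1) =
      ∑ m ∈ Finset.range (3 * n + 1), PowerSeries.C (taylorCoeff n m) * PowerSeries.X ^ m +
      PowerSeries.X ^ (3 * n + 1) * ∑ d ∈ Finset.range (3 * n + 1),
        PowerSeries.C (taylorCoeff n (3 * n - d)) * (PowerSeries.mk 1) ^ (d + 1) := by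
  set J : PowerSeries ℤ := PowerSeries.mk 1 with hJ
  have hJ1 : J * (1 - PowerSeries.X) = 1 := PowerSeries.mk_one_mul_one_sub_eq_one _
  have hJp : ∀ i, J ^ i * (1 - PowerSeries.X) ^ i = 1 := fun i => by rw [← mul_pow, hJ1, one_pow]
  rw [← Finset.sum_range_reflect, Finset.mul_sum, ← Finset.sum_add_distrib, polePartT,
    ← coeToPowerSeries.ringHom_apply, map_sum, Finset.sum_mul]
  refine Finset.sum_congr rfl fun d hd => ?_
  have hd' := Finset.mem_range.1 hd
  rw [coeToPowerSeries.ringHom_apply, show 3 * n + 1 - 1 - d = 3 * n - d by omega]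
  push_cast
  have e1 := hJp (3 * n + 1)
  have e2 := hJp (3 * n - d)
  have e3 : J ^ (3 * n + 1) = J ^ (3 * n - d) * J ^ (d + 1) := by
    rw [← pow_add]; congr 1; omega
  linear_combination (PowerSeries.C (taylorCoeff n (3 * n - d)) * PowerSeries.X ^ (3 * n - d)) * e1
    + (PowerSeries.C (taylorCoeff n (3 * n - d)) * PowerSeries.X ^ (3 * n + 1) * J ^ (d + 1)) * e2
    + (PowerSeries.C (taylorCoeff n (3 * n - d)) * PowerSeries.X ^ (3 * n + 1) *
      (1 - PowerSeries.X) ^ (3 * n - d)) * e3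

lemma coeff_sum_C_mul_X_pow {S : Type*} [CommRing S] (a : ℕ → S) (N m : ℕ) :
    PowerSeries.coeff m (∑ i ∈ Finset.range N, PowerSeries.C (a i) * PowerSeries.X ^ i) =
      if m < N then a m else 0 := by
  simp [PowerSeries.coeff_X_pow]

lemma X_pow_dvd_sub_polePartT (n : ℕ) :
    (X : ℤ[X]) ^ (3 * n + 1) ∣ quinticT ^ (2 * n) - polePartT n := by
  set J : PowerSeries ℤ := PowerSeries.mk 1 with hJ
  have hJ1 : J * (1 - PowerSeries.X) = 1 := PowerSeries.mk_one_mul_one_sub_eq_one _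
  have hJp : J ^ (3 * n + 1) * (1 - PowerSeries.X) ^ (3 * n + 1) = 1 := by
    rw [← mul_pow, hJ1, one_pow]
  have h : (PowerSeries.X : PowerSeries ℤ) ^ (3 * n + 1) ∣
      ((quinticT ^ (2 * n) - polePartT n : ℤ[X]) : PowerSeries ℤ) * J ^ (3 * n + 1) := by
    rw [coe_sub, sub_mul, mul_coe_polePartT, ← sub_sub]
    refine dvd_sub ?_ (dvd_mul_right _ _)
    rw [PowerSeries.X_pow_dvd_iff]
    intro m hm
    rw [map_sub, coeff_sum_C_mul_X_pow, if_pos hm, taylorCoeff, sub_self]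
  have h' := h.mul_right ((1 - PowerSeries.X) ^ (3 * n + 1))
  rw [mul_assoc, hJp, mul_one, PowerSeries.X_pow_dvd_iff] at h'
  rw [X_pow_dvd_iff]
  intro d hd
  rw [← coeff_coe, h' d hd]

lemma quinticY_comp_five_sub : quinticY.comp (5 - X) = -quinticY := by
  simp [quinticY]
  ring

lemma polePart_comp_five_sub (n : ℕ) : (polePart n).comp (5 - X) = polePart n := by
  rw [polePart, sum_comp]
  refine Finset.sum_congr rfl fun d _ => ?_
  simp only [mul_comp, add_comp, pow_comp, X_comp, sub_comp, C_comp, ofNat_comp, Nat.cast_ofNat,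
    sub_sub_cancel]
  ring

lemma natDegree_five_sub_X : (5 - X : ℤ[X]).natDegree = 1 := by
  compute_degree!

lemma natDegree_polePart_le (n : ℕ) : (polePart n).natDegree ≤ 6 * n + 1 := by
  refine natDegree_sum_le_of_forall_le _ _ fun d hd => ?_
  have h1 := natDegree_five_sub_X
  have hX : ∀ i, (X ^ i : ℤ[X]).natDegree ≤ i := fun i => by simp
  have h5 : ∀ i, ((5 - X : ℤ[X]) ^ i).natDegree ≤ i := fun i =>
    (natDegree_pow_le_of_le i h1.le).trans (by simp)
  refine (natDegree_C_mul_le _ _).trans (natDegree_add_le_of_degree_le ?_ ?_)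
  · exact (natDegree_mul_le_of_le (hX _) (h5 _)).trans (by omega)
  · exact (natDegree_mul_le_of_le (hX _) (h5 _)).trans (by omega)

/-- Partial fraction decomposition of `5 * quinticY ^ (2n) / (y (5 - y)) ^ (3n+1)`, together with a
formula for the coefficients of its polynomial part. -/
lemma exists_polynomialPart (n : ℕ) : ∃ P : ℤ[X],
    5 * quinticY ^ (2 * n) = X ^ (3 * n + 1) * (5 - X) ^ (3 * n + 1) * P + polePart n ∧
    (P = 0 ∨ P.natDegree + 2 ≤ 4 * n) ∧
    ∀ k, 5 ^ (k + 1) * P.coeff k = taylorCoeff n (3 * n + 1 + k) -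
      ∑ d ∈ Finset.range (3 * n + 1), taylorCoeff n (3 * n - d) * ((d + k).choose d : ℤ) := by
  set D := 5 * quinticY ^ (2 * n) - polePart n with hD
  have hDcomp : D.comp (C 5 * X) = C (5 ^ (6 * n + 1)) * (quinticT ^ (2 * n) - polePartT n) := by
    rw [hD, sub_comp, mul_comp, pow_comp, quinticY_comp, polePart_comp, mul_pow, ← map_pow,
      show (125 : ℤ) = 5 ^ 3 by norm_num, ← pow_mul, mul_sub]
    simp
    ring
  have hX : X ^ (3 * n + 1) ∣ D := by
    rw [X_pow_dvd_iff]
    intro m hm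
    have := (X_pow_dvd_iff.1 (X_pow_dvd_sub_polePartT n)) m hm
    have h2 := congrArg (coeff · m) hDcomp
    simp only [comp_C_mul_X_coeff, coeff_C_mul, this, mul_zero] at h2
    exact (mul_eq_zero.1 h2).resolve_right (by positivity)
  have hsymm : D.comp (5 - X) = D := by
    rw [hD, sub_comp, polePart_comp_five_sub, mul_comp, pow_comp, quinticY_comp_five_sub,
      Even.neg_pow (even_two_mul n)]
    simp
  have h5 : (5 - X) ^ (3 * n + 1) ∣ D := by
    obtain ⟨E, hE⟩ := hX
    refine ⟨E.comp (5 - X), ?_⟩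
    conv_lhs => rw [← hsymm, hE]
    simp
  obtain ⟨E, hE⟩ := hX
  have h5E : (5 - X) ^ (3 * n + 1) ∣ E := by
    have hprime : Prime (5 - X : ℤ[X]) := by
      have : (5 - X : ℤ[X]) = -(X - C 5) := by simp
      rw [this]
      exact (prime_X_sub_C 5).neg
    refine hprime.pow_dvd_of_dvd_mul_left _ ?_ (hE ▸ h5)
    intro h
    have h' := hprime.dvd_of_dvd_pow h
    obtain ⟨Q, hQ⟩ := h'
    have := congrArg (eval 5) hQ
    simp at this
  obtain ⟨P, hP⟩ := h5E
  have hDP : D = X ^ (3 * n + 1) * (5 - X) ^ (3 * n + 1) * P := by rw [hE, hP, mul_assoc]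
  refine ⟨P, by rw [← hDP, hD]; ring, ?_, fun k => ?_⟩
  · rw [or_iff_not_imp_left]
    intro hP0
    have hne : (5 - X : ℤ[X]) ≠ 0 := fun h => by
      have := natDegree_five_sub_X
      rw [h] at this
      simp at this
    have h1 : D.natDegree = (3 * n + 1) + (3 * n + 1) + P.natDegree := by
      rw [hDP, natDegree_mul (mul_ne_zero (pow_ne_zero _ X_ne_zero) (pow_ne_zero _ hne)) hP0,
        natDegree_mul (pow_ne_zero _ X_ne_zero) (pow_ne_zero _ hne), natDegree_pow, natDegree_pow,
        natDegree_five_sub_X, natDegree_X]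
      ring
    have h2 : D.natDegree ≤ max (10 * n) (6 * n + 1) := by
      refine (natDegree_sub_le _ _).trans (max_le_max ?_ (natDegree_polePart_le n))
      have h3 : quinticY.natDegree ≤ 5 := by
        unfold quinticY
        compute_degree
      refine (natDegree_C_mul_le (5 : ℤ) _).trans ((natDegree_pow_le_of_le _ h3).trans ?_)
      omega
    omega
  · set J : PowerSeries ℤ := PowerSeries.mk 1 with hJ
    have hJ1 : J * (1 - PowerSeries.X) = 1 := PowerSeries.mk_one_mul_one_sub_eq_one _
    have hJp : J ^ (3 * n + 1) * (1 - PowerSeries.X) ^ (3 * n + 1) = 1 := by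
      rw [← mul_pow, hJ1, one_pow]
    have hT : quinticT ^ (2 * n) - polePartT n =
        X ^ (3 * n + 1) * (1 - X) ^ (3 * n + 1) * (C 5 * P.comp (C 5 * X)) := by
      have h1 : C ((5 : ℤ) ^ (6 * n + 1)) ≠ 0 := by simp
      refine mul_left_cancel₀ h1 ?_
      rw [← hDcomp, hDP]
      have h2 : (5 - C 5 * X : ℤ[X]) = C 5 * (1 - X) := by simp; ring
      simp only [mul_comp, pow_comp, X_comp, sub_comp, ofNat_comp, Nat.cast_ofNat, h2, mul_pow]
      simp only [map_pow]
      ring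
    have hS : ((quinticT ^ (2 * n) : ℤ[X]) : PowerSeries ℤ) * J ^ (3 * n + 1) =
        (polePartT n : PowerSeries ℤ) * J ^ (3 * n + 1) +
        PowerSeries.X ^ (3 * n + 1) * ((C 5 * P.comp (C 5 * X) : ℤ[X]) : PowerSeries ℤ) := by
      have := congrArg (fun q : ℤ[X] => (q : PowerSeries ℤ)) hT
      simp only [coe_sub, coe_mul, coe_pow, coe_X, coe_one] at this ⊢
      linear_combination J ^ (3 * n + 1) * this + (PowerSeries.X ^ (3 * n + 1) *
        ((C 5 : ℤ[X]) * (P.comp (C 5 * X) : ℤ[X]) : PowerSeries ℤ)) * hJp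
    rw [mul_coe_polePartT] at hS
    have hc := congrArg (PowerSeries.coeff (k + (3 * n + 1))) hS
    rw [map_add, map_add, coeff_sum_C_mul_X_pow, if_neg (by omega), PowerSeries.coeff_X_pow_mul,
      PowerSeries.coeff_X_pow_mul, coeff_coe, coeff_C_mul, comp_C_mul_X_coeff, map_sum] at hc
    simp only [PowerSeries.coeff_C_mul, PowerSeries.mk_one_pow_eq_mk_choose_add,
      PowerSeries.coeff_mk] at hc
    rw [taylorCoeff, add_comm (3 * n + 1) k, hc]
    ring

end Decomposition

section GaussianDivisibility

open Polynomial in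
lemma four_pow_dvd_taylorCoeff (n m : ℕ) :
    (4 : GaussianInt) ^ n ∣ (⟨1, 1⟩ : GaussianInt) ^ m * (taylorCoeff n m : GaussianInt) := by
  set u : GaussianInt := ⟨1, 1⟩ with hu
  set J : PowerSeries ℤ := PowerSeries.mk 1
  set φ : PowerSeries ℤ →+* PowerSeries GaussianInt :=
    (PowerSeries.rescale u).comp (PowerSeries.map (Int.castRingHom GaussianInt)) with hφ
  have hX : φ PowerSeries.X = PowerSeries.C u * PowerSeries.X := by
    simp [hφ, PowerSeries.rescale_X]
  have hu2 : (PowerSeries.C u : PowerSeries GaussianInt) ^ 2 = 2 * PowerSeries.C ⟨0, 1⟩ := by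
    rw [← map_ofNat (PowerSeries.C (R := GaussianInt)) 2, ← map_mul, ← map_pow]
    congr 1
  have hq : ∃ F, φ (quinticT : PowerSeries ℤ) = 2 * F := by
    refine ⟨(1 - 2 * (PowerSeries.C u * PowerSeries.X)) *
      (1 - 3 * (PowerSeries.C u * PowerSeries.X) + 5 * PowerSeries.C ⟨0, 1⟩ * PowerSeries.X ^ 2) *
      (1 - 4 * (PowerSeries.C u * PowerSeries.X) + 5 * (PowerSeries.C u * PowerSeries.X) ^ 2), ?_⟩
    have : (quinticT : PowerSeries ℤ) = (1 - 2 * PowerSeries.X) *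
        (2 - 6 * PowerSeries.X + 5 * PowerSeries.X ^ 2) *
        (1 - 4 * PowerSeries.X + 5 * PowerSeries.X ^ 2) := by
      have h := fun k : ℤ => coe_C (R := ℤ) k
      have h2 := h 2; have h4 := h 4; have h5 := h 5; have h6 := h 6
      simp only [map_ofNat] at h2 h4 h5 h6
      simp [quinticT, h2, h4, h5, h6]
    rw [this]
    simp only [map_mul, map_add, map_sub, map_pow, map_one, map_ofNat, hX]
    rw [mul_pow (PowerSeries.C u) PowerSeries.X, hu2]
    ring
  obtain ⟨F, hF⟩ := hq
  have hcoef : u ^ m * (taylorCoeff n m : GaussianInt) = PowerSeries.coeff m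
      (φ (((quinticT ^ (2 * n) : ℤ[X]) : PowerSeries ℤ) * J ^ (3 * n + 1))) := by
    rw [hφ, RingHom.comp_apply, PowerSeries.coeff_rescale, PowerSeries.coeff_map]
    rfl
  rw [hcoef, map_mul, coe_pow, map_pow, hF, mul_pow, pow_mul,
    show (2 : PowerSeries GaussianInt) ^ 2 = PowerSeries.C 4 by rw [map_ofNat]; norm_num, ← map_pow,
    mul_assoc, PowerSeries.coeff_C_mul]
  exact dvd_mul_right _ _

lemma isCoprime_four_pow_of_odd {a : ℤ} (ha : Odd a) (n : ℕ) :
    IsCoprime ((4 : GaussianInt) ^ n) (a : GaussianInt) := by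
  have h : IsCoprime ((4 : ℤ) ^ n) a := by
    rw [show (4 : ℤ) = 2 ^ 2 by norm_num]
    exact IsCoprime.pow_left (IsCoprime.pow_left (Int.isCoprime_two_left.2 ha))
  have := h.intCast (R := GaussianInt)
  push_cast at this
  exact this

lemma four_pow_dvd_of_coeff_formula {n k : ℕ} {c : ℤ}
    (h : 5 ^ (k + 1) * c = taylorCoeff n (3 * n + 1 + k) -
      ∑ d ∈ Finset.range (3 * n + 1), taylorCoeff n (3 * n - d) * ((d + k).choose d : ℤ)) :
    (4 : GaussianInt) ^ n ∣ (⟨1, 1⟩ : GaussianInt) ^ (3 * n + 1 + k) * (c : GaussianInt) := by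
  set u : GaussianInt := ⟨1, 1⟩ with hu
  have hodd : Odd ((5 : ℤ) ^ (k + 1)) := Odd.pow (by decide)
  refine (isCoprime_four_pow_of_odd hodd n).dvd_of_dvd_mul_left ?_
  have h' := congrArg (fun z : ℤ => (z : GaussianInt)) h
  push_cast at h' ⊢
  rw [mul_left_comm, h', mul_sub]
  refine dvd_sub (four_pow_dvd_taylorCoeff n _) ?_
  rw [Finset.mul_sum]
  refine Finset.dvd_sum fun d hd => ?_
  have hd' := Finset.mem_range.1 hd
  rw [show 3 * n + 1 + k = (3 * n - d) + (d + 1 + k) by omega, pow_add]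
  obtain ⟨γ, hγ⟩ := four_pow_dvd_taylorCoeff n (3 * n - d)
  refine ⟨γ * u ^ (d + 1 + k) * ((d + k).choose d : GaussianInt), ?_⟩
  linear_combination (u ^ (d + 1 + k) * ((d + k).choose d : GaussianInt)) * hγ

lemma inP.mod_bounds {n p : ℕ} (h : inP n p) :
    p.Prime ∧ 5 < p ∧ p ≤ 2 * (n % p) ∧ 3 * (n % p) < 2 * p := by
  obtain ⟨hp, hmax, h1, h2⟩ := h
  have h5 : (5 : ℝ) < p := (le_max_left _ _).trans_lt hmax
  have hp0 : (0 : ℝ) < p := by linarith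
  rw [Int.fract_div_natCast_eq_div_natCast_mod] at h1 h2
  rw [div_le_div_iff₀ (by norm_num) hp0] at h1
  rw [div_lt_div_iff₀ hp0 (by norm_num)] at h2
  refine ⟨hp, by exact_mod_cast h5, ?_, ?_⟩
  · have : (p : ℝ) ≤ 2 * (n % p : ℕ) := by linarith
    exact_mod_cast this
  · have : (3 : ℝ) * (n % p : ℕ) < 2 * p := by linarith
    exact_mod_cast this

lemma inP.dvd_taylorCoeff {n p d : ℕ} (h : inP n p) (hd : d ≤ 3 * n) (hpd : p ∣ d) :
    (p : ℤ) ∣ taylorCoeff n (3 * n - d) := by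
  obtain ⟨hp, h5, h1, h2⟩ := h.mod_bounds
  have := Fact.mk hp
  refine _root_.dvd_taylorCoeff h1 h2 (by omega) ?_
  push_cast [hd]
  refine Int.modEq_iff_dvd.2 ?_
  rw [sub_sub_cancel]
  exact_mod_cast hpd

lemma inP.dvd_of_coeff_formula {n p k : ℕ} (hP : inP n p) {c : ℤ} (hpk : p ∣ k + 1)
    (h : 5 ^ (k + 1) * c = taylorCoeff n (3 * n + 1 + k) -
      ∑ d ∈ Finset.range (3 * n + 1), taylorCoeff n (3 * n - d) * ((d + k).choose d : ℤ)) :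
    (p : ℤ) ∣ c := by
  obtain ⟨hp, h5, h1, h2⟩ := hP.mod_bounds
  have := Fact.mk hp
  have hpz : Prime (p : ℤ) := Nat.prime_iff_prime_int.1 hp
  have hdvd : (p : ℤ) ∣ 5 ^ (k + 1) * c := by
    rw [h]
    refine dvd_sub (_root_.dvd_taylorCoeff h1 h2 (by omega) ?_) (Finset.dvd_sum fun d hd => ?_)
    · refine Int.modEq_iff_dvd.2 ?_
      push_cast
      rw [show (3 * n - (3 * n + 1 + k) : ℤ) = -((k : ℤ) + 1) by ring, dvd_neg]
      exact_mod_cast hpk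
    · have hd' := Finset.mem_range.1 hd
      by_cases hpd : p ∣ d
      · exact (hP.dvd_taylorCoeff (by omega) hpd).mul_right _
      · refine Dvd.dvd.mul_left ?_ _
        rw [Int.natCast_dvd_natCast]
        cases d with
        | zero => exact absurd (dvd_zero p) hpd
        | succ e =>
          have := Nat.choose_succ_right_eq (e + 1 + k) e
          rw [show e + 1 + k - e = k + 1 by omega] at this
          refine (hp.dvd_mul.1 ?_).resolve_right hpd
          rw [this]
          exact hpk.mul_left _
  refine (hpz.dvd_mul.1 hdvd).resolve_left fun h => ?_
  have h' := hpz.dvd_of_dvd_pow h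
  have := Nat.le_of_dvd (by norm_num) (by exact_mod_cast h' : p ∣ 5)
  omega

lemma dvd_lcmUpTo {d m : ℕ} (h1 : 1 ≤ d) (h2 : d ≤ m) : d ∣ lcmUpTo m :=
  Finset.dvd_lcm (f := id) (Finset.mem_Icc.2 ⟨h1, h2⟩)

lemma L_mul_Phi (n : ℕ) : L n * Phi n = lcmUpTo (4 * n) := by
  refine Nat.div_mul_cancel ?_
  refine Finset.prod_primes_dvd _ (fun p hp => ?_) fun p hp => ?_
  · exact (Finset.mem_filter.1 hp).2.1.prime
  · obtain ⟨h1, h2⟩ := Finset.mem_filter.1 hp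
    have := Finset.mem_range.1 h1
    exact dvd_lcmUpTo h2.1.one_le (by omega)

/-- If `c` is divisible by the primes of `𝒫_n` that divide `d`, then `d` divides `L n * c`. -/
lemma dvd_L_mul {n d : ℕ} (h1 : 1 ≤ d) (h2 : d ≤ 4 * n) {c : GaussianInt}
    (h : ∀ p, inP n p → p ∣ d → (p : GaussianInt) ∣ c) : (d : GaussianInt) ∣ L n * c := by
  set s := (Finset.range (2 * n + 1)).filter (fun p => inP n p) with hs
  set A := ∏ p ∈ s.filter (fun p => p ∣ d), p with hA
  set B := ∏ p ∈ s.filter (fun p => ¬ p ∣ d), p with hB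
  have hAB : A * B = Phi n := Finset.prod_filter_mul_prod_filter_not s _ _
  have hAc : (A : GaussianInt) ∣ c := by
    rw [hA, Nat.cast_prod]
    refine Finset.prod_dvd_of_coprime (fun p hp q hq hpq => ?_) fun p hp => ?_
    · have hp' := (Finset.mem_filter.1 (Finset.mem_filter.1 hp).1).2.1
      have hq' := (Finset.mem_filter.1 (Finset.mem_filter.1 hq).1).2.1
      have := (Nat.isCoprime_iff_coprime.2 ((Nat.coprime_primes hp' hq').2 hpq)).intCast
        (R := GaussianInt)
      simpa [Function.onFun] using this
    · obtain ⟨hp1, hp2⟩ := Finset.mem_filter.1 hp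
      exact h p (Finset.mem_filter.1 hp1).2 hp2
  have hdB : Nat.Coprime d B := by
    refine Nat.Coprime.prod_right fun p hp => ?_
    obtain ⟨hp1, hp2⟩ := Finset.mem_filter.1 hp
    exact ((Finset.mem_filter.1 hp1).2.1.coprime_iff_not_dvd.2 hp2).symm
  have hdLA : d ∣ L n * A := by
    refine hdB.dvd_of_dvd_mul_right ?_
    rw [mul_assoc, hAB, L_mul_Phi]
    exact dvd_lcmUpTo h1 h2
  obtain ⟨c', rfl⟩ := hAc
  rw [← mul_assoc, ← Nat.cast_mul]
  exact (Nat.cast_dvd_cast hdLA).mul_right _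

lemma one_add_I_pow_dvd (n : ℕ) :
    (⟨1, 1⟩ : GaussianInt) ^ (3 * n) ∣ 2 ^ (4 * n - 5 * n / 2) := by
  have h : (2 : GaussianInt) = ⟨1, 1⟩ ^ 2 * ⟨0, -1⟩ := by decide
  rw [h, mul_pow, ← pow_mul]
  exact (pow_dvd_pow _ (by omega)).mul_right _

lemma dvd_L_mul_of_four_pow_mul {n d : ℕ} (h1 : 1 ≤ d) (h2 : d ≤ 4 * n) {m : ℕ} {c : ℤ}
    {γ : GaussianInt} (hγ : (⟨1, 1⟩ : GaussianInt) ^ m * c = 4 ^ n * γ)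
    (h : ∀ p, inP n p → p ∣ d → (p : ℤ) ∣ c) : (d : GaussianInt) ∣ L n * γ := by
  refine dvd_L_mul h1 h2 fun p hp hpd => ?_
  obtain ⟨hp', h5, -, -⟩ := hp.mod_bounds
  have hodd : Odd (p : ℤ) := by exact_mod_cast hp'.odd_of_ne_two (by omega)
  have hco := (isCoprime_four_pow_of_odd hodd n).symm
  push_cast at hco
  refine hco.dvd_of_dvd_mul_left (hγ ▸ Dvd.dvd.mul_left ?_ _)
  have := (Zsqrtd.intCast_dvd_intCast (d := -1) (p : ℤ) c).2 (h p hp hpd)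
  exact_mod_cast this

lemma exists_coeff_formula_integral {n k : ℕ} {c : ℤ} (hk : k + 1 ≤ 4 * n)
    (h : 5 ^ (k + 1) * c = taylorCoeff n (3 * n + 1 + k) -
      ∑ d ∈ Finset.range (3 * n + 1), taylorCoeff n (3 * n - d) * ((d + k).choose d : ℤ)) :
    ∃ z : GaussianInt, L n * 2 ^ (4 * n - 5 * n / 2) * c * (⟨3, 1⟩ : GaussianInt) ^ (k + 1) =
      4 ^ n * ((k + 1 : ℕ) : GaussianInt) * z := by
  obtain ⟨ρ, hρ⟩ := four_pow_dvd_of_coeff_formula h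
  obtain ⟨θ, hθ⟩ := one_add_I_pow_dvd n
  obtain ⟨μ, hμ⟩ := dvd_L_mul_of_four_pow_mul (by omega) hk hρ
    fun p hp hpk => hp.dvd_of_coeff_formula hpk h
  refine ⟨μ * θ * ⟨2, -1⟩ ^ (k + 1), ?_⟩
  have h3 : (⟨3, 1⟩ : GaussianInt) = ⟨1, 1⟩ * ⟨2, -1⟩ := by decide
  rw [hθ, h3, mul_pow]
  rw [show 3 * n + 1 + k = 3 * n + (k + 1) by ring, pow_add] at hρ
  linear_combination (L n * θ * (⟨2, -1⟩ : GaussianInt) ^ (k + 1)) * hρ +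
    (4 ^ n * θ * (⟨2, -1⟩ : GaussianInt) ^ (k + 1)) * hμ

lemma exists_taylorCoeff_integral {n d : ℕ} (h1 : 1 ≤ d) (h2 : d ≤ 3 * n) :
    ∃ z : GaussianInt, L n * 2 ^ (4 * n - 5 * n / 2) * (taylorCoeff n (3 * n - d) : GaussianInt) =
      4 ^ n * (d : GaussianInt) * ⟨1, 1⟩ ^ d * z := by
  obtain ⟨γ, hγ⟩ := four_pow_dvd_taylorCoeff n (3 * n - d)
  obtain ⟨θ, hθ⟩ := one_add_I_pow_dvd n
  obtain ⟨μ, hμ⟩ := dvd_L_mul_of_four_pow_mul h1 (by omega) hγ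
    fun p hp hpd => hp.dvd_taylorCoeff h2 hpd
  refine ⟨μ * θ, ?_⟩
  rw [hθ, show 3 * n = (3 * n - d) + d by omega, pow_add, ← show 3 * n = (3 * n - d) + d by omega]
  linear_combination (L n * θ * (⟨1, 1⟩ : GaussianInt) ^ d) * hγ +
    (4 ^ n * θ * (⟨1, 1⟩ : GaussianInt) ^ d) * hμ

lemma four_pow_dvd_two_pow_mul_taylorCoeff (n : ℕ) :
    (4 : ℤ) ^ n ∣ 2 ^ (4 * n - 5 * n / 2) * taylorCoeff n (3 * n) := by
  obtain ⟨γ, hγ⟩ := four_pow_dvd_taylorCoeff n (3 * n)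
  obtain ⟨θ, hθ⟩ := one_add_I_pow_dvd n
  rw [← Zsqrtd.intCast_dvd_intCast (d := -1)]
  refine ⟨θ * γ, ?_⟩
  have hθ' : (2 : ℤ√(-1)) ^ (4 * n - 5 * n / 2) = ⟨1, 1⟩ ^ (3 * n) * θ := hθ
  push_cast
  rw [hθ']
  linear_combination θ * hγ

end GaussianDivisibility

section Integration

open Complex ComplexConjugate

/-- An antiderivative of `y ^ (-(d+1)) + (5 - y) ^ (-(d+1))`. -/
noncomputable def poleAntideriv (d : ℕ) (y : ℂ) : ℂ :=
  if d = 0 then log y - log (5 - y) else (((5 - y) ^ d)⁻¹ - (y ^ d)⁻¹) / d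

lemma hasDerivAt_poleAntideriv (d : ℕ) {y : ℂ} (hy : y ∈ slitPlane) (hy' : 5 - y ∈ slitPlane) :
    HasDerivAt (poleAntideriv d) ((y ^ (d + 1))⁻¹ + ((5 - y) ^ (d + 1))⁻¹) y := by
  have h0 := slitPlane_ne_zero hy
  have h0' := slitPlane_ne_zero hy'
  have h5 : HasDerivAt (fun z : ℂ => 5 - z) (-1) y := by
    simpa using (hasDerivAt_id y).const_sub 5
  cases d with
  | zero =>
    rw [show poleAntideriv 0 = fun z => log z - log (5 - z) by ext; simp [poleAntideriv]]
    refine ((hasDerivAt_log hy).sub (h5.clog hy')).congr_deriv ?_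
    rw [zero_add, pow_one, pow_one]
    ring
  | succ d =>
    rw [show poleAntideriv (d + 1) = fun z : ℂ => (((5 - z) ^ (d + 1))⁻¹ -
      (z ^ (d + 1))⁻¹) / ((d + 1 : ℕ) : ℂ) by ext; simp [poleAntideriv]]
    have hd : ((d + 1 : ℕ) : ℂ) ≠ 0 := Nat.cast_ne_zero.2 (Nat.succ_ne_zero d)
    refine ((((h5.pow (d + 1)).inv (pow_ne_zero _ h0')).sub
      ((hasDerivAt_pow (d + 1) y).inv (pow_ne_zero _ h0))).div_const
        ((d + 1 : ℕ) : ℂ)).congr_deriv ?_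
    simp only [Nat.add_sub_cancel, Pi.pow_apply]
    field_simp
    ring

lemma R_five_sub (n : ℕ) {P : Polynomial ℤ} (hP : 5 * quinticY ^ (2 * n) =
      Polynomial.X ^ (3 * n + 1) * (5 - Polynomial.X) ^ (3 * n + 1) * P + polePart n)
    (hdeg : P = 0 ∨ P.natDegree + 2 ≤ 4 * n) {y : ℂ} (hy : y ≠ 0) (hy' : 5 - y ≠ 0) :
    R n (5 - 2 * y) = 4 ^ n / 4 * (∑ k ∈ Finset.range (4 * n), (P.coeff k : ℂ) * y ^ k +
      ∑ d ∈ Finset.range (3 * n + 1), (5 ^ d * taylorCoeff n (3 * n - d) : ℂ) *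
        ((y ^ (d + 1))⁻¹ + ((5 - y) ^ (d + 1))⁻¹)) := by
  have hPy : ∑ k ∈ Finset.range (4 * n), (P.coeff k : ℂ) * y ^ k = Polynomial.aeval y P := by
    rcases hdeg with rfl | h
    · simp
    · rw [Polynomial.aeval_eq_sum_range' (show P.natDegree < 4 * n by omega)]
      simp
  have hpole : ∑ d ∈ Finset.range (3 * n + 1), (5 ^ d * taylorCoeff n (3 * n - d) : ℂ) *
        ((y ^ (d + 1))⁻¹ + ((5 - y) ^ (d + 1))⁻¹) =
      Polynomial.aeval y (polePart n) / (y ^ (3 * n + 1) * (5 - y) ^ (3 * n + 1)) := by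
    rw [polePart, map_sum, Finset.sum_div]
    refine Finset.sum_congr rfl fun d hd => ?_
    have hd' := Finset.mem_range.1 hd
    have e1 : ∀ z : ℂ, z ^ (3 * n + 1) = z ^ (3 * n - d) * z ^ (d + 1) := fun z => by
      rw [← pow_add]; congr 1; omega
    simp only [map_mul, map_add, map_pow, map_sub, Polynomial.aeval_X, Polynomial.aeval_C,
      map_ofNat, e1]
    simp
    field_simp
  have hev := congrArg (Polynomial.aeval y) hP
  simp only [quinticY, map_mul, map_add, map_pow, map_sub, Polynomial.aeval_X, map_ofNat] at hev
  have hnum : 5 * (5 - 2 * y) ^ (2 * n) * ((5 - 2 * y) ^ 4 + 6 * (5 - 2 * y) ^ 2 + 25) ^ (2 * n) =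
      16 ^ (2 * n) * (5 * ((5 - 2 * y) * (y ^ 2 - 6 * y + 10) * (y ^ 2 - 4 * y + 5)) ^ (2 * n)) := by
    rw [show (5 - 2 * y) ^ 4 + 6 * (5 - 2 * y) ^ 2 + 25 =
      16 * ((y ^ 2 - 6 * y + 10) * (y ^ 2 - 4 * y + 5)) by ring]
    simp only [mul_pow]
    ring
  have hden : (5 + (5 - 2 * y)) ^ (3 * n + 1) * (5 - (5 - 2 * y)) ^ (3 * n + 1) =
      4 ^ (3 * n + 1) * (y ^ (3 * n + 1) * (5 - y) ^ (3 * n + 1)) := by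
    rw [← mul_pow, ← mul_pow, ← mul_pow]
    congr 1
    ring
  rw [hPy, hpole, R, hnum, hden, hev]
  have h16 : (16 : ℂ) ^ (2 * n) = 4 ^ n * 4 ^ (3 * n) := by
    rw [← pow_add, show (16 : ℂ) = 4 ^ 2 by norm_num, ← pow_mul]
    congr 1
    ring
  rw [h16]
  field_simp
  ring

lemma integral_R (n : ℕ) {P : Polynomial ℤ} (hP : 5 * quinticY ^ (2 * n) =
      Polynomial.X ^ (3 * n + 1) * (5 - Polynomial.X) ^ (3 * n + 1) * P + polePart n)
    (hdeg : P = 0 ∨ P.natDegree + 2 ≤ 4 * n) :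
    ∫ t in (-1 : ℝ)..1, R n (-1 + 2 * I * t) * (2 * I) =
      4 ^ n / 2 * (∑ k ∈ Finset.range (4 * n),
          (P.coeff k : ℂ) * (((3 + I) ^ (k + 1) - (3 - I) ^ (k + 1)) / (k + 1 : ℕ)) +
        ∑ d ∈ Finset.range (3 * n + 1), (5 ^ d * taylorCoeff n (3 * n - d) : ℂ) *
          (poleAntideriv d (3 + I) - poleAntideriv d (3 - I))) := by
  set F : ℂ → ℂ := fun y => ∑ k ∈ Finset.range (4 * n),
      (P.coeff k : ℂ) * (y ^ (k + 1) / (k + 1 : ℕ)) +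
    ∑ d ∈ Finset.range (3 * n + 1), (5 ^ d * taylorCoeff n (3 * n - d) : ℂ) *
      poleAntideriv d y with hF
  have hslit : ∀ t : ℝ, (3 - I * t) ∈ slitPlane ∧ 5 - (3 - I * t) ∈ slitPlane := fun t => by
    constructor <;> refine Or.inl ?_ <;> norm_num
  have hderiv : ∀ t ∈ Set.uIcc (-1 : ℝ) 1,
      HasDerivAt (fun s : ℝ => -(4 ^ n / 2) * F (3 - I * s))
        (R n (-1 + 2 * I * t) * (2 * I)) t := fun t _ => by
    obtain ⟨h1, h2⟩ := hslit t
    have hFd : HasDerivAt F (∑ k ∈ Finset.range (4 * n), (P.coeff k : ℂ) * (3 - I * t) ^ k +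
        ∑ d ∈ Finset.range (3 * n + 1), (5 ^ d * taylorCoeff n (3 * n - d) : ℂ) *
          (((3 - I * t) ^ (d + 1))⁻¹ + ((5 - (3 - I * t)) ^ (d + 1))⁻¹)) (3 - I * t) := by
      refine HasDerivAt.add (HasDerivAt.fun_sum fun k _ => ?_)
        (HasDerivAt.fun_sum fun d _ => (hasDerivAt_poleAntideriv d h1 h2).const_mul _)
      refine HasDerivAt.const_mul _ ?_
      have hk : ((k + 1 : ℕ) : ℂ) ≠ 0 := Nat.cast_ne_zero.2 (Nat.succ_ne_zero k)
      convert (hasDerivAt_pow (k + 1) (3 - I * t : ℂ)).div_const ((k + 1 : ℕ) : ℂ) using 1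
      rw [Nat.add_sub_cancel]
      field_simp
    have hin : HasDerivAt (fun z : ℂ => 3 - I * z) (-I) (t : ℂ) := by
      simpa using ((hasDerivAt_id (t : ℂ)).const_mul I).const_sub 3
    have := ((hFd.comp (t : ℂ) hin).const_mul (-(4 ^ n / 2 : ℂ))).comp_ofReal
    refine this.congr_deriv ?_
    rw [show (-1 + 2 * I * t : ℂ) = 5 - 2 * (3 - I * t) by ring,
      R_five_sub n hP hdeg (slitPlane_ne_zero h1) (slitPlane_ne_zero h2)]
    ring
  have hcont : Continuous fun t : ℝ => R n (-1 + 2 * I * t) * (2 * I) := by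
    unfold R
    refine Continuous.mul (Continuous.div (by fun_prop) (by fun_prop) fun t => ?_) continuous_const
    refine mul_ne_zero (pow_ne_zero _ fun h => ?_) (pow_ne_zero _ fun h => ?_) <;>
      · have := congrArg re h
        norm_num at this
  rw [intervalIntegral.integral_eq_sub_of_hasDerivAt hderiv (hcont.intervalIntegrable _ _)]
  simp only [hF, ofReal_one, ofReal_neg, mul_neg, mul_one, sub_neg_eq_add, sub_div, mul_sub,
    Finset.sum_sub_distrib]
  ring

lemma poleAntideriv_zero_sub :
    poleAntideriv 0 (3 + I) - poleAntideriv 0 (3 - I) = Real.pi * I / 2 := by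
  have hlog : log (3 + I) + log (2 + I) = log (5 + 5 * I) := by
    rw [show (5 + 5 * I : ℂ) = (3 + I) * (2 + I) by ring_nf; rw [I_sq]; ring]
    refine (log_mul ?_ ?_ ?_).symm
    · intro h; have := congrArg re h; norm_num at this
    · intro h; have := congrArg re h; norm_num at this
    · have h3 := abs_arg_lt_pi_div_two_iff.2 (Or.inl (show 0 < (3 + I).re by norm_num))
      have h2 := abs_arg_lt_pi_div_two_iff.2 (Or.inl (show 0 < (2 + I).re by norm_num))
      rw [abs_lt] at h3 h2
      constructor <;> linarith [h3.1, h3.2, h2.1, h2.2]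
  have harg : arg (5 + 5 * I) = Real.pi / 4 := by
    have hmem : Real.pi / 4 ∈ Set.Ioc (-Real.pi) Real.pi := by
      constructor <;> linarith [Real.pi_pos]
    have h := arg_mul_cos_add_sin_mul_I (show 0 < 5 * √2 by positivity) hmem
    rw [← ofReal_cos, ← ofReal_sin, Real.cos_pi_div_four, Real.sin_pi_div_four] at h
    rw [← h]
    congr 1
    have h2 : (√2 : ℂ) * √2 = 2 := by
      rw [← ofReal_mul, Real.mul_self_sqrt (by norm_num), ofReal_ofNat]
    push_cast
    linear_combination (-(5 / 2) * (1 + I)) * h2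
  have hconj : ∀ z : ℂ, 0 < z.re → log (conj z) = conj (log z) := fun z hz =>
    log_conj z (by
      have := abs_arg_lt_pi_div_two_iff.2 (Or.inl hz)
      rw [abs_lt] at this
      linarith [this.2, Real.pi_pos])
  have h3 : log (3 - I) = conj (log (3 + I)) := by
    rw [← hconj _ (by norm_num)]
    simp [sub_eq_add_neg, map_ofNat conj]
  have h2 : log (2 - I) = conj (log (2 + I)) := by
    rw [← hconj _ (by norm_num)]
    simp [sub_eq_add_neg, map_ofNat conj]
  have him := sub_conj (log (5 + 5 * I))
  rw [log_im, harg, ← hlog, map_add, ← h3, ← h2] at him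
  rw [poleAntideriv, poleAntideriv, if_pos rfl, if_pos rfl,
    show (5 : ℂ) - (3 + I) = 2 - I by ring, show (5 : ℂ) - (3 - I) = 2 + I by ring]
  push_cast at him
  linear_combination him

lemma poleAntideriv_sub {d : ℕ} (hd : d ≠ 0) :
    5 ^ d * (poleAntideriv d (3 + I) - poleAntideriv d (3 - I)) =
      (((3 + I) / 2) ^ d - ((3 - I) / 2) ^ d + ((2 + I) ^ d - (2 - I) ^ d)) / d := by
  have h1 : (5 : ℂ) / (3 + I) = (3 - I) / 2 := by
    rw [div_eq_div_iff (by intro h; have := congrArg re h; norm_num at this) two_ne_zero]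
    ring_nf; rw [I_sq]; norm_num
  have h2 : (5 : ℂ) / (3 - I) = (3 + I) / 2 := by
    rw [div_eq_div_iff (by intro h; have := congrArg re h; norm_num at this) two_ne_zero]
    ring_nf; rw [I_sq]; norm_num
  have h3 : (5 : ℂ) / (5 - (3 + I)) = 2 + I := by
    rw [div_eq_iff (by intro h; have := congrArg re h; norm_num at this)]
    ring_nf; rw [I_sq]; norm_num
  have h4 : (5 : ℂ) / (5 - (3 - I)) = 2 - I := by
    rw [div_eq_iff (by intro h; have := congrArg re h; norm_num at this)]
    ring_nf; rw [I_sq]; norm_num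
  rw [poleAntideriv, poleAntideriv, if_neg hd, if_neg hd, ← h1, ← h2, ← h3, ← h4]
  simp only [div_pow]
  ring

lemma GaussianInt.toComplex_sub_conj (z : GaussianInt) :
    GaussianInt.toComplex z - conj (GaussianInt.toComplex z) = 2 * I * (z.im : ℤ) := by
  rw [sub_conj, ← GaussianInt.intCast_im]
  push_cast
  ring

lemma exists_int_coeff_mul_sub {n k : ℕ} {c : ℤ} (hk : k + 1 ≤ 4 * n)
    (h : 5 ^ (k + 1) * c = taylorCoeff n (3 * n + 1 + k) -
      ∑ d ∈ Finset.range (3 * n + 1), taylorCoeff n (3 * n - d) * ((d + k).choose d : ℤ)) :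
    ∃ m : ℤ, (L n : ℂ) * 2 ^ (4 * n - 5 * n / 2) *
      (c * (((3 + I) ^ (k + 1) - (3 - I) ^ (k + 1)) / (k + 1 : ℕ))) = 4 ^ n * (2 * I * m) := by
  obtain ⟨z, hz⟩ := exists_coeff_formula_integral hk h
  have h1 := congrArg GaussianInt.toComplex hz
  simp only [map_mul, map_pow, map_natCast, map_intCast, map_ofNat] at h1
  rw [show GaussianInt.toComplex ⟨3, 1⟩ = 3 + I by simp [GaussianInt.toComplex_def']] at h1
  have h2 := congrArg conj h1
  simp only [map_mul, map_pow, map_natCast, map_intCast, map_ofNat, map_add, conj_I] at h2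
  refine ⟨z.im, ?_⟩
  have hk0 : ((k + 1 : ℕ) : ℂ) ≠ 0 := Nat.cast_ne_zero.2 (Nat.succ_ne_zero k)
  rw [← GaussianInt.toComplex_sub_conj]
  field_simp
  linear_combination h1 - h2

lemma exists_int_taylorCoeff_mul_sub {n d : ℕ} (h1 : 1 ≤ d) (h2 : d ≤ 3 * n) :
    ∃ m : ℤ, (L n : ℂ) * 2 ^ (4 * n - 5 * n / 2) * ((5 ^ d * taylorCoeff n (3 * n - d) : ℂ) *
      (poleAntideriv d (3 + I) - poleAntideriv d (3 - I))) = 4 ^ n * (2 * I * m) := by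
  obtain ⟨z, hz⟩ := exists_taylorCoeff_integral h1 h2
  have e1 := congrArg GaussianInt.toComplex hz
  simp only [map_mul, map_pow, map_natCast, map_intCast, map_ofNat] at e1
  rw [show GaussianInt.toComplex ⟨1, 1⟩ = 1 + I by simp [GaussianInt.toComplex_def']] at e1
  have e2 := congrArg conj e1
  simp only [map_mul, map_pow, map_natCast, map_intCast, map_ofNat, map_add, map_one, conj_I]
    at e2
  refine ⟨(z * (⟨1, 2⟩ ^ d + (⟨1, 3⟩ : GaussianInt) ^ d)).im, ?_⟩
  have hd0 : (d : ℂ) ≠ 0 := Nat.cast_ne_zero.2 (by omega)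
  have f1 : (1 + I) ^ d * ((3 + I) / 2) ^ d = (1 + 2 * I) ^ d := by
    rw [← mul_pow]; congr 1; linear_combination I_sq / 2
  have f2 : (1 + I) ^ d * (2 + I) ^ d = (1 + 3 * I) ^ d := by
    rw [← mul_pow]; congr 1; linear_combination I_sq
  have f3 : (1 - I) ^ d * ((3 - I) / 2) ^ d = (1 - 2 * I) ^ d := by
    rw [← mul_pow]; congr 1; linear_combination I_sq / 2
  have f4 : (1 - I) ^ d * (2 - I) ^ d = (1 - 3 * I) ^ d := by
    rw [← mul_pow]; congr 1; linear_combination I_sq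
  rw [← GaussianInt.toComplex_sub_conj]
  simp only [map_mul, map_pow, map_add]
  rw [show GaussianInt.toComplex ⟨1, 2⟩ = 1 + 2 * I by simp [GaussianInt.toComplex_def'],
    show GaussianInt.toComplex ⟨1, 3⟩ = 1 + 3 * I by simp [GaussianInt.toComplex_def']]
  simp only [map_mul, map_add, map_one, map_ofNat, conj_I, mul_neg, ← sub_eq_add_neg] at e2 ⊢
  rw [mul_right_comm ((5 : ℂ) ^ d), poleAntideriv_sub (by omega), ← f1, ← f2, ← f3, ← f4]
  field_simp
  linear_combination (((3 + I) / 2) ^ d + (2 + I) ^ d) * e1 -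
    (((3 - I) / 2) ^ d + (2 - I) ^ d) * e2

lemma exists_int_integral_R (n : ℕ) :
    ∃ a b : ℤ, (L n : ℂ) * 2 ^ (4 * n - 5 * n / 2) *
      ∫ t in (-1 : ℝ)..1, R n (-1 + 2 * I * t) * (2 * I) =
        16 ^ n * (I * a + b * (Real.pi * I) / 4) := by
  obtain ⟨P, hP, hdeg, hcoeff⟩ := exists_polynomialPart n
  have hpoly : ∀ k ∈ Finset.range (4 * n), ∃ m : ℤ, (L n : ℂ) * 2 ^ (4 * n - 5 * n / 2) *
      (P.coeff k * (((3 + I) ^ (k + 1) - (3 - I) ^ (k + 1)) / (k + 1 : ℕ))) =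
        4 ^ n * (2 * I * m) :=
    fun k hk => exists_int_coeff_mul_sub (Finset.mem_range.1 hk) (hcoeff k)
  have hpole : ∀ d ∈ Finset.range (3 * n), ∃ m : ℤ, (L n : ℂ) * 2 ^ (4 * n - 5 * n / 2) *
      ((5 ^ (d + 1) * taylorCoeff n (3 * n - (d + 1)) : ℂ) *
        (poleAntideriv (d + 1) (3 + I) - poleAntideriv (d + 1) (3 - I))) = 4 ^ n * (2 * I * m) :=
    fun d hd => exists_int_taylorCoeff_mul_sub (Nat.le_add_left 1 d) (Finset.mem_range.1 hd)
  choose! u hu using hpoly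
  choose! v hv using hpole
  obtain ⟨c, hc⟩ := four_pow_dvd_two_pow_mul_taylorCoeff n
  have hc' : (2 : ℂ) ^ (4 * n - 5 * n / 2) * taylorCoeff n (3 * n) = 4 ^ n * c := by
    exact_mod_cast hc
  refine ⟨∑ k ∈ Finset.range (4 * n), u k + ∑ d ∈ Finset.range (3 * n), v d, L n * c, ?_⟩
  have hu' := Finset.sum_congr rfl hu
  have hv' := Finset.sum_congr rfl hv
  simp only [← Finset.mul_sum] at hu' hv'
  rw [integral_R n hP hdeg, Finset.sum_range_succ', poleAntideriv_zero_sub,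
    show (16 : ℂ) ^ n = 4 ^ n * 4 ^ n by rw [← mul_pow]; norm_num]
  push_cast
  simp only [pow_zero, one_mul, Nat.sub_zero]
  push_cast at hu' hv'
  linear_combination (4 ^ n / 2 : ℂ) * hu' + (4 ^ n / 2 : ℂ) * hv' +
    (4 ^ n / 4 * L n * (Real.pi * I) : ℂ) * hc'

end Integration

/-- **Proposition 1.** For every `n ≥ 0` there are integers `a, b` with
`2^{-⌊5n/2⌋+2} L_n I_n = a + b π`. -/
theorem Proposition1 (n : ℕ) :
    ∃ a b : ℤ, (2 : ℂ) ^ ((2 : ℤ) - ((5 * n / 2 : ℕ) : ℤ)) * (L n : ℂ) * In n =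
      (a : ℂ) + (b : ℂ) * (Real.pi : ℂ) := by
  obtain ⟨a, b, h⟩ := exists_int_integral_R n
  refine ⟨(-1) ^ n * (4 * a), (-1) ^ n * b, ?_⟩
  have h2 : (2 : ℂ) ^ ((2 : ℤ) - ((5 * n / 2 : ℕ) : ℤ)) * 16 ^ n =
      4 * 2 ^ (4 * n - 5 * n / 2) := by
    rw [show (16 : ℂ) ^ n = 2 ^ ((4 * n : ℕ) : ℤ) by rw [zpow_natCast, pow_mul]; norm_num,
      ← zpow_add₀ two_ne_zero, show (4 : ℂ) = 2 ^ ((2 : ℕ) : ℤ) by norm_num, ← zpow_natCast,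
      ← zpow_add₀ two_ne_zero]
    congr 1
    omega
  have h16 : (16 : ℂ) ^ n ≠ 0 := pow_ne_zero _ (by norm_num)
  refine mul_left_cancel₀ h16 ?_
  rw [In]
  simp only [Int.cast_mul, Int.cast_pow, Int.cast_neg, Int.cast_one, Int.cast_ofNat]
  generalize (∫ t in (-1 : ℝ)..1, R n (-1 + 2 * Complex.I * t) * (2 * Complex.I)) = J at h ⊢
  linear_combination (L n * (Complex.I * (-1) ^ (n + 1) * J)) * h2 +
    (4 * Complex.I * (-1) ^ (n + 1)) * h +
    (16 ^ n * (-1) ^ (n + 1) * (4 * a + b * Real.pi)) * Complex.I_sq
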